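/- arXiv:2502.15125 — 2 statements merged into one kernel-verified Lean document; each statement's English description precedes it below -/
import Mathlib

section
/- Let 1 < p < ∞ and ω ∈ A₁, and define ‖f‖_{BMO^p(ω)} = sup over all cubes Q of ( (1/ω(Q)) ∫_Q |f(x) − f_Q|^p ω(x)^{1−p} dx )^{1/p}. Then for every locally integrable f, ‖f‖_{BMO(ω)} ≤ ‖f‖_{BMO^p(ω)}, and there exists a constant C > 0 depending only on n, p and ω (in particular independent of f) such that ‖f‖_{BMO^p(ω)} ≤ C · ‖f‖_{BMO(ω)}; hence the norms ‖·‖_{BMO^p(ω)} and ‖·‖_{BMO(ω)} are equivalent. -/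
open MeasureTheory Metric Set ENNReal

noncomputable section

namespace LPW

variable {n : ℕ}

/-- n-dimensional Euclidean space. -/
abbrev Rn (n : ℕ) := EuclideanSpace ℝ (Fin n)

/-- Axis-parallel open cube with center `c` and half-side `h`. -/
def cube (c : Rn n) (h : ℝ) : Set (Rn n) := {y : Rn n | ∀ i, |y i - c i| < h}

/-- The ω-measure `ω(E) = ∫_E ω`. -/
def wInt (ω : Rn n → ℝ) (E : Set (Rn n)) : ℝ := ∫ x in E, ω x

/-- The Lebesgue mean value `f_E = (1/m(E)) ∫_E f`. -/
def avg (f : Rn n → ℝ) (E : Set (Rn n)) : ℝ := ((volume E).toReal)⁻¹ * ∫ x in E, f x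

/-- Weighted mean oscillation `(1/ω(E)) ∫_E |f - f_E|`. -/
def bmoAvg (ω f : Rn n → ℝ) (E : Set (Rn n)) : ℝ :=
  (wInt ω E)⁻¹ * ∫ x in E, |f x - avg f E|

/-- Weighted lower oscillation `(1/ω(E)) ∫_E (f - essinf_E f)`. -/
def bloAvg (ω f : Rn n → ℝ) (E : Set (Rn n)) : ℝ :=
  (wInt ω E)⁻¹ * ∫ x in E, (f x - essInf f (volume.restrict E))

/-- `‖f‖_{BMO(ω)}`, supremum over all balls, valued in `[0,∞]`. -/
def bmoNorm (ω f : Rn n → ℝ) : ℝ≥0∞ :=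
  ⨆ (c : Rn n) (ρ : ℝ) (_ : 0 < ρ), ENNReal.ofReal (bmoAvg ω f (Metric.ball c ρ))

/-- `‖f‖_{BLO(ω)}`, supremum over all balls, valued in `[0,∞]`. -/
def bloNorm (ω f : Rn n → ℝ) : ℝ≥0∞ :=
  ⨆ (c : Rn n) (ρ : ℝ) (_ : 0 < ρ), ENNReal.ofReal (bloAvg ω f (Metric.ball c ρ))

/-- `‖f‖_{L^∞(ω)}`, supremum over all balls of `(essinf_B ω)⁻¹ · esssup_B |f|`. -/
def linfNorm (ω f : Rn n → ℝ) : ℝ≥0∞ :=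
  ⨆ (c : Rn n) (ρ : ℝ) (_ : 0 < ρ),
    ENNReal.ofReal ((essInf ω (volume.restrict (Metric.ball c ρ)))⁻¹ *
      essSup (fun x => |f x|) (volume.restrict (Metric.ball c ρ)))

/-- `‖f‖_{BMO(ω)}` taken over cubes. -/
def bmoNormC (ω f : Rn n → ℝ) : ℝ≥0∞ :=
  ⨆ (c : Rn n) (h : ℝ) (_ : 0 < h), ENNReal.ofReal (bmoAvg ω f (cube c h))

/-- `‖f‖_{BLO(ω)}` taken over cubes. -/
def bloNormC (ω f : Rn n → ℝ) : ℝ≥0∞ :=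
  ⨆ (c : Rn n) (h : ℝ) (_ : 0 < h), ENNReal.ofReal (bloAvg ω f (cube c h))

/-- `‖f‖_{BMO^p(ω)}` taken over cubes (extended-valued). -/
def bmoPNorm (p : ℝ) (ω f : Rn n → ℝ) : ℝ≥0∞ :=
  ⨆ (c : Rn n) (h : ℝ) (_ : 0 < h),
    ((ENNReal.ofReal (wInt ω (cube c h)))⁻¹ *
      ∫⁻ x in cube c h,
        ENNReal.ofReal (|f x - avg f (cube c h)| ^ p * (ω x) ^ (1 - p))) ^ (1/p)

/-- `‖f‖_{BLO^p(ω)}` taken over cubes (extended-valued). -/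
def bloPNorm (p : ℝ) (ω f : Rn n → ℝ) : ℝ≥0∞ :=
  ⨆ (c : Rn n) (h : ℝ) (_ : 0 < h),
    ((ENNReal.ofReal (wInt ω (cube c h)))⁻¹ *
      ∫⁻ x in cube c h,
        ENNReal.ofReal ((f x - essInf f (volume.restrict (cube c h))) ^ p * (ω x) ^ (1 - p))) ^ (1/p)

/-- A weight: nonnegative, locally integrable, positive a.e. -/
def IsWeight (ω : Rn n → ℝ) : Prop :=
  (∀ x, 0 ≤ ω x) ∧ LocallyIntegrable ω volume ∧
    ∀ᵐ x ∂(volume : Measure (Rn n)), 0 < ω x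

/-- `C` is an `A₁` bound for `ω` (over balls). -/
def A1ballBound (ω : Rn n → ℝ) (C : ℝ) : Prop :=
  0 < C ∧ ∀ (c : Rn n) (ρ : ℝ), 0 < ρ →
    avg ω (Metric.ball c ρ) ≤ C * essInf ω (volume.restrict (Metric.ball c ρ))

/-- `ω ∈ A₁` (over balls). -/
def IsA1ball (ω : Rn n → ℝ) : Prop := ∃ C, A1ballBound ω C

/-- `[ω]_{A₁}` (over balls), the least `A₁` bound. -/
def A1ballConst (ω : Rn n → ℝ) : ℝ := sInf {C | A1ballBound ω C}

/-- `C` is an `A₁` bound for `ω` (over cubes). -/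
def A1cubeBound (ω : Rn n → ℝ) (C : ℝ) : Prop :=
  0 < C ∧ ∀ (c : Rn n) (h : ℝ), 0 < h →
    avg ω (cube c h) ≤ C * essInf ω (volume.restrict (cube c h))

/-- `ω ∈ A₁` (over cubes). -/
def IsA1cube (ω : Rn n → ℝ) : Prop := ∃ C, A1cubeBound ω C

/-- `[ω]_{A₁}` (over cubes), the least `A₁` bound. -/
def A1cubeConst (ω : Rn n → ℝ) : ℝ := sInf {C | A1cubeBound ω C}

/-- `C` is an `A₂` bound for `ω` (over balls). -/
def A2ballBound (ω : Rn n → ℝ) (C : ℝ) : Prop :=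
  0 < C ∧ ∀ (c : Rn n) (ρ : ℝ), 0 < ρ →
    avg ω (Metric.ball c ρ) * avg (fun x => (ω x)⁻¹) (Metric.ball c ρ) ≤ C

/-- `ω ∈ A₂` (over balls). -/
def IsA2ball (ω : Rn n → ℝ) : Prop := ∃ C, A2ballBound ω C

/-- `[ω]_{A₂}` (over balls), the least `A₂` bound. -/
def A2ballConst (ω : Rn n → ℝ) : ℝ := sInf {C | A2ballBound ω C}

/-- Conditions (P1), (P2), (P3) on the kernel ψ. -/
def PsiKernel (n : ℕ) (C₁ C₂ δ γ : ℝ) (ψ : Rn n → ℝ) : Prop :=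
  Integrable ψ volume ∧ (∫ x, ψ x) = 0 ∧
  (∀ x : Rn n, |ψ x| ≤ C₁ * (1 + ‖x‖) ^ (-((n : ℝ) + δ))) ∧
  (∀ x h : Rn n, 2 * ‖h‖ ≤ ‖x‖ →
    |ψ (x + h) - ψ x| ≤ C₂ * ‖h‖ ^ γ * (1 + ‖x‖) ^ (-((n : ℝ) + δ + γ)))

/-- The convolution `(ψ_t * f)(x)` where `ψ_t(x) = t^{-n} ψ(x/t)`. -/
def cvl (ψ : Rn n → ℝ) (t : ℝ) (f : Rn n → ℝ) (x : Rn n) : ℝ :=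
  ∫ y, (t ^ n)⁻¹ * ψ (t⁻¹ • (x - y)) * f y

/-- The generalized Littlewood–Paley g-function `G(f)(x)`, valued in `[0,∞]`. -/
def Gfun (ψ f : Rn n → ℝ) (x : Rn n) : ℝ≥0∞ :=
  (∫⁻ t in Ioi (0:ℝ), ENNReal.ofReal ((cvl ψ t f x) ^ 2 / t)) ^ (1/2 : ℝ)

/-- The dilated Lusin area integral `S_a(f)(x)` (aperture `a`), valued in `[0,∞]`. -/
def Sdil (ψ : Rn n → ℝ) (a : ℝ) (f : Rn n → ℝ) (x : Rn n) : ℝ≥0∞ :=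
  (∫⁻ t in Ioi (0:ℝ), ∫⁻ y in Metric.ball x (a * t),
      ENNReal.ofReal ((cvl ψ t f y) ^ 2 / t ^ (n + 1))) ^ (1/2 : ℝ)

/-- The generalized Lusin area integral `S(f)(x)`, valued in `[0,∞]`. -/
def Sfun (ψ f : Rn n → ℝ) (x : Rn n) : ℝ≥0∞ := Sdil ψ 1 f x

/-- Stein's function `G*_λ(f)(x)`, valued in `[0,∞]`. -/
def Gstar (ψ : Rn n → ℝ) (lam : ℝ) (f : Rn n → ℝ) (x : Rn n) : ℝ≥0∞ :=
  (∫⁻ t in Ioi (0:ℝ), ∫⁻ y,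
      ENNReal.ofReal ((t / (t + dist x y)) ^ (lam * (n : ℝ)) *
        (cvl ψ t f y) ^ 2 / t ^ (n + 1))) ^ (1/2 : ℝ)


open Filter Topology
/-- Index of the dyadic cell of generation `k` containing `x`. -/
def czq {n : ℕ} (c : Fin n → ℝ) (h : ℝ) (k : ℕ) (x : Fin n → ℝ) : Fin n → ℤ :=
  fun i => ⌊2 ^ k * ((x i - c i + h) / (2 * h))⌋

/-- Center of a dyadic cell. -/
def czctr {n : ℕ} (c : Fin n → ℝ) (h : ℝ) (k : ℕ) (m : Fin n → ℤ) : Fin n → ℝ :=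
  fun i => c i - h + (2 * m i + 1) * (h / 2 ^ k)

lemma czr_pos {h : ℝ} (hh : 0 < h) (k : ℕ) : 0 < h / 2 ^ k := by positivity

lemma czq_eq_iff {n : ℕ} (c : Fin n → ℝ) {h : ℝ} (hh : 0 < h) (k : ℕ) (x : Fin n → ℝ) (i : Fin n)
    (z : ℤ) : czq c h k x i = z ↔
      c i - h + 2 * z * (h / 2 ^ k) ≤ x i ∧ x i < c i - h + (2 * z + 2) * (h / 2 ^ k) := by
  have hr := czr_pos hh k
  have e : 2 ^ k * ((x i - c i + h) / (2 * h)) = (x i - c i + h) / (2 * (h / 2 ^ k)) := by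
    field_simp
  unfold czq
  rw [Int.floor_eq_iff, e, le_div_iff₀ (by positivity), div_lt_iff₀ (by positivity)]
  constructor
  · rintro ⟨h1, h2⟩; constructor <;> nlinarith
  · rintro ⟨h1, h2⟩; constructor <;> nlinarith

lemma czq_of_mem {n : ℕ} (c : Fin n → ℝ) {h : ℝ} (hh : 0 < h) (k : ℕ) (m : Fin n → ℤ)
    (z : Fin n → ℝ) (hz : z ∈ ball (czctr c h k m) (h / 2 ^ k)) : czq c h k z = m := by
  have hr := czr_pos hh k
  rw [mem_ball, dist_pi_lt_iff hr] at hz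
  funext i
  have := hz i
  rw [Real.dist_eq, abs_lt] at this
  simp only [czctr] at this
  rw [czq_eq_iff c hh]
  constructor <;> nlinarith

lemma mem_closedBall_czq {n : ℕ} (c : Fin n → ℝ) {h : ℝ} (hh : 0 < h) (k : ℕ)
    (z : Fin n → ℝ) : z ∈ closedBall (czctr c h k (czq c h k z)) (h / 2 ^ k) := by
  have hr := czr_pos hh k
  rw [mem_closedBall, dist_pi_le_iff hr.le]
  intro i
  obtain ⟨h1, h2⟩ := (czq_eq_iff c hh k z i _).1 rfl
  rw [Real.dist_eq, abs_le]
  simp only [czctr]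
  constructor <;> nlinarith

lemma czq_succ {n : ℕ} (c : Fin n → ℝ) {h : ℝ} (hh : 0 < h) (k : ℕ)
    (z : Fin n → ℝ) : czq c h k z = fun i => czq c h (k+1) z i / 2 := by
  have hr := czr_pos hh k
  funext i
  obtain ⟨h1, h2⟩ := (czq_eq_iff c hh (k+1) z i _).1 rfl
  rw [czq_eq_iff c hh]
  set w := czq c h (k+1) z i
  have e : h / 2 ^ (k+1) = h / 2 ^ k / 2 := by rw [pow_succ]; field_simp
  rw [e] at h1 h2
  have h3 : (2 * (w/2 : ℤ) : ℝ) ≤ w := by exact_mod_cast (by omega : 2 * (w/2) ≤ w)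
  have h4 : (w : ℝ) + 1 ≤ 2 * (w/2 : ℤ) + 2 := by exact_mod_cast (by omega : w + 1 ≤ 2 * (w/2) + 2)
  constructor <;> nlinarith

lemma czq_le {n : ℕ} (c : Fin n → ℝ) {h : ℝ} (hh : 0 < h) {k : ℕ}
    {x z : Fin n → ℝ} (hxz : czq c h k x = czq c h k z) {j : ℕ} (hj : j ≤ k) :
    czq c h j x = czq c h j z := by
  induction k, hj using Nat.le_induction with
  | base => exact hxz
  | succ k hk ih =>
    apply ih
    rw [czq_succ c hh, hxz, ← czq_succ c hh]

lemma cz_ball_sub {n : ℕ} (c : Fin n → ℝ) {h : ℝ} (hh : 0 < h) (k : ℕ) (x : Fin n → ℝ) :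
    ball (czctr c h (k+1) (czq c h (k+1) x)) (h / 2 ^ (k+1)) ⊆
    ball (czctr c h k (czq c h k x)) (h / 2 ^ k) := by
  intro z hz
  have hr := czr_pos hh k
  have hr' := czr_pos hh (k+1)
  rw [mem_ball, dist_pi_lt_iff hr'] at hz
  rw [mem_ball, dist_pi_lt_iff hr]
  intro i
  have := hz i
  rw [Real.dist_eq, abs_lt] at this ⊢
  rw [czq_succ c hh k]
  simp only [czctr] at this ⊢
  set w := czq c h (k+1) x i
  have e : h / 2 ^ (k+1) = h / 2 ^ k / 2 := by rw [pow_succ]; field_simp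
  rw [e] at this
  have h3 : (2 * (w/2 : ℤ) : ℝ) ≤ w := by exact_mod_cast (by omega : 2 * (w/2) ≤ w)
  have h4 : (w : ℝ) + 1 ≤ 2 * (w/2 : ℤ) + 2 := by exact_mod_cast (by omega : w + 1 ≤ 2 * (w/2) + 2)
  constructor <;> nlinarith

lemma cz_zero {n : ℕ} (c : Fin n → ℝ) {h : ℝ} (hh : 0 < h) (x : Fin n → ℝ) (hx : x ∈ ball c h) :
    ball (czctr c h 0 (czq c h 0 x)) (h / 2 ^ 0) = ball c h := by
  have e : czctr c h 0 0 = c := by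
    funext i; simp [czctr]
  have : czq c h 0 x = 0 := by
    apply czq_of_mem c hh
    rw [e]; simpa using hx
  rw [this, e]; simp

theorem cz_pi {n : ℕ} (g : (Fin n → ℝ) → ℝ) (hg0 : ∀ x, 0 ≤ g x)
    (hg : LocallyIntegrable g volume) (c : Fin n → ℝ) (h : ℝ) (hh : 0 < h) (lam : ℝ)
    (havg : ∫ x in ball c h, g x ≤ lam * volume.real (ball c h)) :
    ∃ (S : Set (ℕ × (Fin n → ℤ))) (ctr : ℕ × (Fin n → ℤ) → Fin n → ℝ) (r : ℕ × (Fin n → ℤ) → ℝ),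
      (∀ s ∈ S, 0 < r s ∧ ball (ctr s) (r s) ⊆ ball c h ∧
        lam * volume.real (ball (ctr s) (r s)) ≤ ∫ x in ball (ctr s) (r s), g x ∧
        ∫ x in ball (ctr s) (r s), g x ≤ 2 ^ n * lam * volume.real (ball (ctr s) (r s))) ∧
      S.PairwiseDisjoint (fun s => ball (ctr s) (r s)) ∧
      ∀ᵐ x, x ∈ ball c h → x ∉ ⋃ s ∈ S, ball (ctr s) (r s) → g x ≤ lam := by
  classical
  set B : ℕ → (Fin n → ℤ) → Set (Fin n → ℝ) := fun k m => ball (czctr c h k m) (h / 2 ^ k) with hB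
  set Bad : ℕ → (Fin n → ℤ) → Prop := fun k m => lam * volume.real (B k m) < ∫ x in B k m, g x
    with hBad
  have hsub : ∀ x ∈ ball c h, ∀ k, B k (czq c h k x) ⊆ ball c h := by
    intro x hx k
    induction k with
    | zero => exact (cz_zero c hh x hx).subset
    | succ k ih => exact (cz_ball_sub c hh k x).trans ih
  have hbint : ∀ (y : Fin n → ℝ) r, IntegrableOn g (ball y r) := fun y r =>
    (hg.integrableOn_isCompact (isCompact_closedBall y r)).mono_set ball_subset_closedBall
  have hvol : ∀ k m m', volume.real (B k m) = 2 ^ n * volume.real (B (k+1) m') := by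
    intro k m m'
    have hr := czr_pos hh k
    have hr' := czr_pos hh (k+1)
    simp only [hB, Measure.real]
    rw [Real.volume_pi_ball _ hr, Real.volume_pi_ball _ hr', ENNReal.toReal_ofReal (by positivity),
      ENNReal.toReal_ofReal (by positivity), Fintype.card_fin, ← mul_pow]
    congr 1
    rw [pow_succ]; field_simp
  have hnull : ∀ᵐ x : Fin n → ℝ, ∀ k, x ∈ B k (czq c h k x) := by
    have : ∀ᵐ x : Fin n → ℝ, ∀ k (m : Fin n → ℤ), x ∉ sphere (czctr c h k m) (h / 2 ^ k) := by
      rw [ae_all_iff]; intro k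
      rw [ae_all_iff]; intro m
      rw [← measure_eq_zero_iff_ae_notMem]
      exact Measure.addHaar_sphere_of_ne_zero _ _ (czr_pos hh k).ne'
    filter_upwards [this] with x hx k
    have h1 := mem_closedBall_czq c hh k x
    have h2 := hx k (czq c h k x)
    rw [mem_closedBall] at h1
    rw [mem_sphere] at h2
    exact mem_ball.2 (lt_of_le_of_ne h1 h2)
  refine ⟨{s | ∃ x ∈ ball c h, czq c h s.1 x = s.2 ∧ Bad s.1 s.2 ∧ ∀ j < s.1, ¬ Bad j (czq c h j x)},
    fun s => czctr c h s.1 s.2, fun s => h / 2 ^ s.1, ?_, ?_, ?_⟩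
  · rintro ⟨k, m⟩ ⟨x, hx, hxm, hb, hj⟩
    simp only at hxm hb hj ⊢
    subst hxm
    refine ⟨czr_pos hh k, hsub x hx k, hb.le, ?_⟩
    cases k with
    | zero =>
      exfalso
      have e := cz_zero c hh x hx
      simp only [hBad, hB, e] at hb
      linarith
    | succ k =>
      have h1 := not_lt.1 (hj k (Nat.lt_succ_self k))
      rw [hvol k _ (czq c h (k+1) x)] at h1
      calc _ ≤ ∫ x in B k (czq c h k x), g x :=
            setIntegral_mono_set (hbint _ _) (ae_of_all _ hg0)
              (LE.le.eventuallyLE (cz_ball_sub c hh k x))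
        _ ≤ _ := by rw [mul_comm (2 ^ n) lam, mul_assoc]; exact h1
  · rintro ⟨k, m⟩ ⟨x, hx, hxm, hb, hj⟩ ⟨k', m'⟩ ⟨x', hx', hxm', hb', hj'⟩ hne
    simp only at hxm hb hj hxm' hb' hj'
    refine Set.disjoint_left.2 fun z hz hz' => hne ?_
    have e1 := czq_of_mem c hh k m z hz
    have e2 := czq_of_mem c hh k' m' z hz'
    have hk : k = k' := by
      rcases lt_trichotomy k k' with hlt | heq | hlt
      · exfalso
        apply hj' k hlt
        rw [czq_le c hh (hxm'.trans e2.symm) hlt.le, e1]; exact hb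
      · exact heq
      · exfalso
        apply hj k' hlt
        rw [czq_le c hh (hxm.trans e1.symm) hlt.le, e2]; exact hb'
    subst hk
    rw [← e1, ← e2]
  · have hL := IsUnifLocDoublingMeasure.ae_tendsto_average (volume : Measure (Fin n → ℝ)) hg 1
    filter_upwards [hL, hnull] with x hLx hnx hx hxU
    have hnb : ∀ k, ¬ Bad k (czq c h k x) := by
      by_contra hcon
      push Not at hcon
      apply hxU
      simp only [mem_iUnion]
      refine ⟨(Nat.find hcon, czq c h (Nat.find hcon) x), ⟨x, hx, rfl, Nat.find_spec hcon,
        fun j hj => Nat.find_min hcon hj⟩, hnx _⟩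
    have hlim : Tendsto (fun k : ℕ => h / 2 ^ k) atTop (𝓝[>] 0) := by
      rw [tendsto_nhdsWithin_iff]
      refine ⟨?_, Eventually.of_forall fun k => czr_pos hh k⟩
      have := (tendsto_pow_atTop_nhds_zero_of_lt_one (r := (1/2:ℝ)) (by norm_num) (by norm_num)).const_mul h
      simpa [div_eq_mul_inv] using this
    have ht := hLx (fun k => czctr c h k (czq c h k x)) _ hlim
      (Eventually.of_forall fun k => by rw [one_mul]; exact mem_closedBall_czq c hh k x)
    refine le_of_tendsto ht (Eventually.of_forall fun k => ?_)
    have hk := not_lt.1 (hnb k)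
    have hr := czr_pos hh k
    have hae : closedBall (czctr c h k (czq c h k x)) (h / 2 ^ k) =ᵐ[volume] B k (czq c h k x) := by
      rw [← ball_union_sphere]
      exact union_ae_eq_left_of_ae_eq_empty (by
        rw [ae_eq_empty]; exact Measure.addHaar_sphere_of_ne_zero _ _ hr.ne')
    rw [setAverage_congr hae, setAverage_eq, smul_eq_mul]
    have hpos : 0 < volume.real (B k (czq c h k x)) := 
      ENNReal.toReal_pos (measure_ball_pos _ _ hr).ne' measure_ball_lt_top.ne
    rw [inv_mul_le_iff₀ hpos, mul_comm]
    exact hk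


lemma cube_eq {n : ℕ} (c : Rn n) {h : ℝ} (hh : 0 < h) :
    cube c h = (@WithLp.ofLp 2 (Fin n → ℝ)) ⁻¹' (ball (WithLp.ofLp c) h) := by
  ext y
  simp only [cube, mem_ofPred_eq, mem_preimage, mem_ball, dist_pi_lt_iff hh, Real.dist_eq]

lemma ofLp_emb (n : ℕ) : MeasurableEmbedding (@WithLp.ofLp 2 (Fin n → ℝ)) :=
  (MeasurableEquiv.toLp 2 (Fin n → ℝ)).symm.measurableEmbedding

lemma toLp_emb (n : ℕ) : MeasurableEmbedding (@WithLp.toLp 2 (Fin n → ℝ)) :=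
  (MeasurableEquiv.toLp 2 (Fin n → ℝ)).measurableEmbedding

lemma cube_meas {n : ℕ} (c : Rn n) {h : ℝ} (hh : 0 < h) : MeasurableSet (cube c h) := by
  rw [cube_eq c hh]
  exact (ofLp_emb n).measurable measurableSet_ball

lemma cube_volume {n : ℕ} (c : Rn n) {h : ℝ} (hh : 0 < h) :
    volume (cube c h) = volume (ball (WithLp.ofLp c) h) := by
  rw [cube_eq c hh]
  exact (PiLp.volume_preserving_ofLp (Fin n)).measure_preimage measurableSet_ball.nullMeasurableSet

lemma cube_integral {n : ℕ} (c : Rn n) {h : ℝ} (hh : 0 < h) (g : Rn n → ℝ) :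
    ∫ x in cube c h, g x = ∫ y in ball (WithLp.ofLp c) h, g (WithLp.toLp 2 y) := by
  rw [cube_eq c hh]
  exact (PiLp.volume_preserving_ofLp (Fin n)).setIntegral_preimage_emb (ofLp_emb n)
    (fun y => g (WithLp.toLp 2 y)) _

lemma cube_ne_top {n : ℕ} (c : Rn n) {h : ℝ} (hh : 0 < h) : volume (cube c h) ≠ ∞ := by
  rw [cube_volume c hh]; exact measure_ball_lt_top.ne

lemma cube_real_pos {n : ℕ} (c : Rn n) {h : ℝ} (hh : 0 < h) : 0 < volume.real (cube c h) := by
  refine ENNReal.toReal_pos ?_ (cube_ne_top c hh)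
  rw [cube_volume c hh]; exact (measure_ball_pos _ _ hh).ne'

lemma cube_integrable {n : ℕ} (c : Rn n) {h : ℝ} (hh : 0 < h) {g : Rn n → ℝ}
    (hg : LocallyIntegrable g volume) : IntegrableOn g (cube c h) := by
  have hK : IsCompact ((@WithLp.toLp 2 (Fin n → ℝ)) '' closedBall (WithLp.ofLp c) h) :=
    (isCompact_closedBall _ _).image (PiLp.continuous_toLp 2 _)
  refine (hg.integrableOn_isCompact hK).mono_set ?_
  intro x hx
  rw [cube_eq c hh] at hx
  exact ⟨WithLp.ofLp x, ball_subset_closedBall hx, rfl⟩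

theorem cz_cube {n : ℕ} (g : Rn n → ℝ) (hg0 : ∀ x, 0 ≤ g x)
    (hg : LocallyIntegrable g volume) (c : Rn n) (h : ℝ) (hh : 0 < h) (lam : ℝ)
    (havg : ∫ x in cube c h, g x ≤ lam * volume.real (cube c h)) :
    ∃ (S : Set (ℕ × (Fin n → ℤ))) (ctr : ℕ × (Fin n → ℤ) → Rn n) (r : ℕ × (Fin n → ℤ) → ℝ),
      (∀ s ∈ S, 0 < r s ∧ cube (ctr s) (r s) ⊆ cube c h ∧
        lam * volume.real (cube (ctr s) (r s)) ≤ ∫ x in cube (ctr s) (r s), g x ∧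
        ∫ x in cube (ctr s) (r s), g x ≤ 2 ^ n * lam * volume.real (cube (ctr s) (r s))) ∧
      S.PairwiseDisjoint (fun s => cube (ctr s) (r s)) ∧
      ∀ᵐ x, x ∈ cube c h → x ∉ ⋃ s ∈ S, cube (ctr s) (r s) → g x ≤ lam := by
  have hg' : LocallyIntegrable (fun y : Fin n → ℝ => g (WithLp.toLp 2 y)) volume := by
    rw [locallyIntegrable_iff]
    intro K hK
    have hK' : IsCompact ((@WithLp.ofLp 2 (Fin n → ℝ)) ⁻¹' K) := by
      have : (@WithLp.ofLp 2 (Fin n → ℝ)) ⁻¹' K = (@WithLp.toLp 2 (Fin n → ℝ)) '' K := by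
        ext x; constructor
        · intro hx; exact ⟨_, hx, rfl⟩
        · rintro ⟨y, hy, rfl⟩; exact hy
      rw [this]
      exact hK.image (PiLp.continuous_toLp 2 _)
    have := hg.integrableOn_isCompact hK'
    exact ((PiLp.volume_preserving_ofLp (Fin n)).integrableOn_comp_preimage (ofLp_emb n)
      (f := fun y => g (WithLp.toLp 2 y))).1 this
  have hr : ∀ (c : Rn n) {h : ℝ} (hh : 0 < h), volume.real (cube c h) =
      volume.real (ball (WithLp.ofLp c) h) := fun c h hh => by
    simp only [Measure.real, cube_volume c hh]
  rw [cube_integral c hh, hr c hh] at havg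
  obtain ⟨S, ctr, r, h1, h2, h3⟩ := cz_pi _ (fun y => hg0 _) hg' (WithLp.ofLp c) h hh lam havg
  have hcube : ∀ s ∈ S, cube (WithLp.toLp 2 (ctr s)) (r s) =
      (@WithLp.ofLp 2 (Fin n → ℝ)) ⁻¹' ball (ctr s) (r s) := fun s hs => cube_eq _ (h1 s hs).1
  refine ⟨S, fun s => WithLp.toLp 2 (ctr s), r, ?_, ?_, ?_⟩
  · intro s hs
    obtain ⟨a1, a2, a3, a4⟩ := h1 s hs
    refine ⟨a1, ?_, ?_, ?_⟩
    · rw [cube_eq _ a1, cube_eq _ hh]; exact preimage_mono a2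
    · rw [cube_integral _ a1, hr _ a1]; exact a3
    · rw [cube_integral _ a1, hr _ a1]; exact a4
  · intro s hs t ht hst
    simp only [Function.onFun]
    rw [hcube s hs, hcube t ht]
    exact (h2 hs ht hst).preimage _
  · have := (PiLp.volume_preserving_ofLp (Fin n)).quasiMeasurePreserving.ae h3
    filter_upwards [this] with x hx hxc hxU
    refine hx ?_ ?_
    · rw [cube_eq _ hh] at hxc; exact hxc
    · intro hcon
      apply hxU
      simp only [mem_iUnion] at hcon ⊢
      obtain ⟨s, hs, hcs⟩ := hcon
      refine ⟨s, hs, ?_⟩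
      rw [hcube s hs]; exact hcs

lemma wInt_pos {n : ℕ} {ω : Rn n → ℝ} (hω : IsWeight ω) (c : Rn n) {h : ℝ} (hh : 0 < h) :
    0 < wInt ω (cube c h) := by
  obtain ⟨h0, hl, hp⟩ := hω
  unfold wInt
  rw [setIntegral_pos_iff_support_of_nonneg_ae (ae_of_all _ h0) (cube_integrable c hh hl)]
  have : volume (Function.support ω ∩ cube c h) = volume (cube c h) := by
    apply measure_congr
    filter_upwards [hp] with x hx
    apply propext
    constructor
    · intro hy; exact hy.2
    · intro hy; exact ⟨hx.ne', hy⟩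
  rw [this, cube_volume c hh]
  exact measure_ball_pos _ _ hh

lemma a1_ae {n : ℕ} {ω : Rn n → ℝ} (hω : IsWeight ω) {K : ℝ} (hK : A1cubeBound ω K)
    (c : Rn n) {h : ℝ} (hh : 0 < h) :
    ∀ᵐ x, x ∈ cube c h → wInt ω (cube c h) / volume.real (cube c h) ≤ K * ω x := by
  have h1 := hK.2 c h hh
  have h2 : ∀ᵐ x ∂(volume.restrict (cube c h)), essInf ω (volume.restrict (cube c h)) ≤ ω x :=
    ae_essInf_le ⟨0, by
      rw [Filter.eventually_map]
      exact ae_of_all _ hω.1⟩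
  rw [ae_restrict_iff' (cube_meas c hh)] at h2
  filter_upwards [h2] with x hx hxc
  have h3 := mul_le_mul_of_nonneg_left (hx hxc) hK.1.le
  have h4 : wInt ω (cube c h) / volume.real (cube c h) = avg ω (cube c h) := by
    unfold wInt avg Measure.real
    rw [div_eq_inv_mul]
  rw [h4]; linarith

/-- The weighted measure. -/
def wMeas {n : ℕ} (ω : Rn n → ℝ) : Measure (Rn n) :=
  (volume : Measure (Rn n)).withDensity (fun x => ENNReal.ofReal (ω x))

lemma wMeas_eq {n : ℕ} {ω : Rn n → ℝ} (hω : IsWeight ω) {s : Set (Rn n)}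
    (hs : IntegrableOn ω s) : wMeas ω s = ENNReal.ofReal (wInt ω s) := by
  unfold wMeas wInt
  rw [withDensity_apply', ofReal_integral_eq_lintegral_ofReal hs (ae_of_all _ hω.1)]

lemma avg_sub_le {n : ℕ} {f : Rn n → ℝ} (hf : LocallyIntegrable f volume) (c : Rn n) {h : ℝ}
    (hh : 0 < h) (a L : ℝ)
    (hL : ∫ x in cube c h, |f x - a| ≤ L * volume.real (cube c h)) :
    |avg f (cube c h) - a| ≤ L := by
  have hV := cube_real_pos c hh
  have hfi := cube_integrable c hh hf
  have hfin : IsFiniteMeasure (volume.restrict (cube c h)) :=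
    ⟨by rw [Measure.restrict_apply_univ]; exact (cube_ne_top c hh).lt_top⟩
  have e : avg f (cube c h) - a = (volume.real (cube c h))⁻¹ * ∫ x in cube c h, (f x - a) := by
    rw [integral_sub hfi (integrable_const a), setIntegral_const, smul_eq_mul]
    unfold avg
    change (volume.real (cube c h))⁻¹ * _ - _ = _
    field_simp
  rw [e, abs_mul, abs_of_pos (inv_pos.2 hV), inv_mul_le_iff₀ hV, mul_comm]
  exact (abs_integral_le_integral_abs).trans hL

theorem good_lambda {n : ℕ} {ω : Rn n → ℝ} (hω : IsWeight ω) {K : ℝ} (hK1 : 1 ≤ K)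
    (hK : A1cubeBound ω K) {f : Rn n → ℝ} (hf : LocallyIntegrable f volume) {N : ℝ} (hN0 : 0 < N)
    (hN : ∀ (c : Rn n) (h : ℝ), 0 < h →
      ∫ x in cube c h, |f x - avg f (cube c h)| ≤ N * wInt ω (cube c h)) (k : ℕ) :
    ∀ (c : Rn n) (h : ℝ), 0 < h →
      wMeas ω (cube c h ∩ {x | k * (2 ^ (n+1) * K * N) * ω x < |f x - avg f (cube c h)|}) ≤
        (ENNReal.ofReal (1 - 1 / (2 * K))) ^ k * wMeas ω (cube c h) := by
  induction k with
  | zero =>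
    intro c h hh
    simp only [pow_zero, one_mul]
    exact measure_mono inter_subset_left
  | succ k ih =>
    intro c h hh
    have hK0 : 0 < K := by linarith
    set P := cube c h with hP
    set a := avg f P with ha
    set w := wInt ω P with hw
    set V := volume.real P with hV
    have hwpos : 0 < w := wInt_pos hω c hh
    have hVpos : 0 < V := cube_real_pos c hh
    set lam := 2 * N * w / V with hlam
    have hlampos : 0 < lam := by positivity
    have hlamV : lam * V = 2 * N * w := by rw [hlam]; field_simp
    have hNP : ∫ x in P, |f x - a| ≤ N * w := hN c h hh
    have hgl : LocallyIntegrable (fun x => |f x - a|) volume :=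
      fun x => by
        obtain ⟨s, hs, hi⟩ := (hf.sub (locallyIntegrable_const a)) x
        exact ⟨s, hs, hi.norm⟩
    obtain ⟨S, ctr, r, h1, h2, h3⟩ := cz_cube (fun x => |f x - a|) (fun x => abs_nonneg _) hgl c h hh
      lam (by rw [← hP, ← hV, hlamV]; nlinarith)
    rw [← hP] at h1 h3
    set Q : S → Set (Rn n) := fun s => cube (ctr s) (r s) with hQ
    have hQm : ∀ s, MeasurableSet (Q s) := fun s => cube_meas _ (h1 s s.2).1
    have hQd : Pairwise (Function.onFun Disjoint Q) := fun s t hst =>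
      h2 s.2 t.2 (fun e => hst (Subtype.ext e))
    set U := ⋃ s, Q s with hU
    have hUm : MeasurableSet U := MeasurableSet.iUnion hQm
    have hUP : U ⊆ P := iUnion_subset fun s => (h1 s s.2).2.1
    have hPm : MeasurableSet P := cube_meas c hh
    have hPfin : volume P ≠ ∞ := cube_ne_top c hh
    have hfin : IsFiniteMeasure (volume.restrict P) :=
      ⟨by rw [Measure.restrict_apply_univ]; exact hPfin.lt_top⟩
    have hgi : IntegrableOn (fun x => |f x - a|) P := cube_integrable c hh hgl
    have hωi : IntegrableOn ω P := cube_integrable c hh hω.2.1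
    have hci : ∀ b : ℝ, IntegrableOn (fun _ : Rn n => b) P := fun b => integrable_const b
    -- Lebesgue measure of U
    have hUvol : volume.real U ≤ V / 2 := by
      have e1 : 0 ≤ ∫ x in U, (|f x - a| - lam) := by
        have hi : IntegrableOn (fun x => |f x - a| - lam) U := (hgi.sub (hci lam)).mono_set hUP
        rw [hU, integral_iUnion hQm hQd hi]
        refine tsum_nonneg fun s => ?_
        have hs := (h1 s s.2).2.1
        rw [integral_sub (hgi.mono_set hs) ((hci lam).mono_set hs), setIntegral_const, smul_eq_mul]
        have : lam * volume.real (Q s) ≤ ∫ x in Q s, |f x - a| := (h1 s s.2).2.2.1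
        linarith
      rw [integral_sub (hgi.mono_set hUP) ((hci lam).mono_set hUP), setIntegral_const,
        smul_eq_mul] at e1
      have e2 : ∫ x in U, |f x - a| ≤ ∫ x in P, |f x - a| :=
        setIntegral_mono_set hgi (ae_of_all _ fun x => abs_nonneg _) hUP.eventuallyLE
      have : lam * volume.real U ≤ lam * (V / 2) := by nlinarith
      exact le_of_mul_le_mul_left this hlampos
    have hA := a1_ae hω hK c hh
    rw [← hP, ← hw, ← hV] at hA
    -- weighted measure of U
    have hUw : wMeas ω U ≤ ENNReal.ofReal (1 - 1 / (2 * K)) * wMeas ω P := by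
      rw [wMeas_eq hω hωi, wMeas_eq hω (hωi.mono_set hUP), ← ENNReal.ofReal_mul']
      swap
      · exact hwpos.le
      apply ENNReal.ofReal_le_ofReal
      have e1 : wInt ω P = wInt ω U + wInt ω (P \ U) := by
        unfold wInt
        rw [← setIntegral_union disjoint_sdiff_right (hPm.diff hUm) (hωi.mono_set hUP)
          (hωi.mono_set sdiff_subset), union_sdiff_cancel hUP]
      have e2 : volume.real (P \ U) * (w / (K * V)) ≤ wInt ω (P \ U) := by
        rw [← smul_eq_mul, ← setIntegral_const]
        refine setIntegral_mono_on_ae ((hci _).mono_set sdiff_subset) (hωi.mono_set sdiff_subset)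
          (hPm.diff hUm) ?_
        filter_upwards [hA] with x hx hxP
        have := hx hxP.1
        rw [div_le_iff₀ hVpos] at this
        rw [div_le_iff₀ (by positivity)]
        linarith
      have e3 : volume.real (P \ U) = V - volume.real U :=
        measureReal_sdiff hUP hUm hPfin
      have e4 : V / 2 * (w / (K * V)) ≤ wInt ω (P \ U) :=
        (mul_le_mul_of_nonneg_right (by linarith) (by positivity)).trans e2
      have e5 : V / 2 * (w / (K * V)) = 1 / (2 * K) * w := by field_simp
      rw [← hw]
      rw [← hw] at e1
      linarith
    have hac : wMeas ω ≪ volume := withDensity_absolutelyContinuous _ _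
    set A := 2 ^ (n+1) * K * N with hAdef
    have hsub : (P ∩ {x | ((k + 1 : ℕ) : ℝ) * A * ω x < |f x - a|} : Set (Rn n)) ≤ᵐ[wMeas ω]
        ⋃ s, (Q s ∩ {x | k * A * ω x < |f x - avg f (Q s)|} : Set (Rn n)) := by
      apply hac.ae_le
      filter_upwards [hA, h3] with x hxA hx3
      rintro ⟨hxP, hxk⟩
      have hxk : ((k + 1 : ℕ) : ℝ) * A * ω x < |f x - a| := hxk
      have hxA := hxA hxP
      have hl : lam ≤ 2 * N * (K * ω x) := by
        rw [hlam, mul_div_assoc]; gcongr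
      have hω0 := hω.1 x
      have h2n : (1:ℝ) ≤ 2 ^ n := one_le_pow₀ (by norm_num)
      have hl2 : 2 ^ n * lam ≤ A * ω x := by
        calc 2 ^ n * lam ≤ 2 ^ n * (2 * N * (K * ω x)) := by gcongr
          _ = A * ω x := by rw [hAdef]; ring
      have hAω : 0 ≤ k * A * ω x := by positivity
      push_cast at hxk
      have hxU : x ∈ ⋃ s ∈ S, cube (ctr s) (r s) := by
        by_contra hcon
        have := hx3 hxP hcon
        nlinarith
      simp only [mem_iUnion] at hxU
      obtain ⟨s, hs, hxs⟩ := hxU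
      refine mem_iUnion.2 ⟨⟨s, hs⟩, hxs, ?_⟩
      change k * A * ω x < |f x - avg f (cube (ctr s) (r s))|
      have := avg_sub_le hf (ctr s) (h1 s hs).1 a _ (h1 s hs).2.2.2
      have tri : |f x - a| ≤ |f x - avg f (cube (ctr s) (r s))| + |avg f (cube (ctr s) (r s)) - a| :=
        abs_sub_le _ _ _
      nlinarith
    calc _ ≤ wMeas ω (⋃ s, (Q s ∩ {x | k * A * ω x < |f x - avg f (Q s)|})) :=
          measure_mono_ae hsub
      _ ≤ ∑' s, wMeas ω (Q s ∩ {x | k * A * ω x < |f x - avg f (Q s)|}) := measure_iUnion_le _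
      _ ≤ ∑' s, (ENNReal.ofReal (1 - 1 / (2 * K))) ^ k * wMeas ω (Q s) :=
          ENNReal.tsum_le_tsum fun s => ih _ _ (h1 s s.2).1
      _ = (ENNReal.ofReal (1 - 1 / (2 * K))) ^ k * wMeas ω U := by
          rw [ENNReal.tsum_mul_left, measure_iUnion hQd hQm]
      _ ≤ (ENNReal.ofReal (1 - 1 / (2 * K))) ^ k *
          (ENNReal.ofReal (1 - 1 / (2 * K)) * wMeas ω P) := by gcongr
      _ = _ := by rw [pow_succ, mul_assoc]


lemma easy_dir {n : ℕ} {p : ℝ} (hp : 1 < p) {ω : Rn n → ℝ} (hω : IsWeight ω)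
    {f : Rn n → ℝ} (hf : LocallyIntegrable f volume) : bmoNormC ω f ≤ bmoPNorm p ω f := by
  unfold bmoNormC bmoPNorm
  refine iSup_mono fun c => iSup_mono fun h => iSup_mono fun hh => ?_
  set P := cube c h with hP
  set a := avg f P with ha
  have hp0 : 0 < p := by linarith
  have hw : 0 < wInt ω P := wInt_pos hω c hh
  have hfi : IntegrableOn f P := cube_integrable c hh hf
  have hωi : IntegrableOn ω P := cube_integrable c hh hω.2.1
  have hfin : IsFiniteMeasure (volume.restrict P) :=
    ⟨by rw [Measure.restrict_apply_univ]; exact (cube_ne_top c hh).lt_top⟩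
  have hgi : Integrable (fun x => |f x - a|) (volume.restrict P) :=
    (hfi.sub (integrable_const a)).norm
  have hpq : p.HolderConjugate (p / (p - 1)) := Real.HolderConjugate.conjExponent hp
  have hgm : AEMeasurable (fun x => |f x - a|) (volume.restrict P) := hgi.aemeasurable
  have hωm : AEMeasurable ω (volume.restrict P) := hωi.aemeasurable
  have hH := ENNReal.lintegral_mul_le_Lp_mul_Lq (volume.restrict P) hpq
    (f := fun x => ENNReal.ofReal (|f x - a| * ω x ^ ((1 - p) / p)))
    (g := fun x => ENNReal.ofReal (ω x ^ ((p - 1) / p)))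
    (hgm.mul (hωm.pow_const _)).ennreal_ofReal (hωm.pow_const _).ennreal_ofReal
  have hpos : ∀ᵐ x ∂(volume.restrict P), 0 < ω x := ae_restrict_of_ae hω.2.2
  have e1 : ∫⁻ x in P, ((fun x => ENNReal.ofReal (|f x - a| * ω x ^ ((1 - p) / p))) *
      (fun x => ENNReal.ofReal (ω x ^ ((p - 1) / p)))) x = ENNReal.ofReal (∫ x in P, |f x - a|) := by
    rw [ofReal_integral_eq_lintegral_ofReal hgi (ae_of_all _ fun x => abs_nonneg _)]
    refine lintegral_congr_ae ?_
    filter_upwards [hpos] with x hx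
    simp only [Pi.mul_apply]
    rw [← ENNReal.ofReal_mul (by positivity), mul_assoc, ← Real.rpow_add hx]
    have : (1 - p) / p + (p - 1) / p = 0 := by ring
    rw [this, Real.rpow_zero, mul_one]
  have e2 : ∫⁻ x in P, ENNReal.ofReal (|f x - a| * ω x ^ ((1 - p) / p)) ^ p =
      ∫⁻ x in P, ENNReal.ofReal (|f x - a| ^ p * ω x ^ (1 - p)) := by
    refine lintegral_congr_ae ?_
    filter_upwards [hpos] with x hx
    rw [ENNReal.ofReal_rpow_of_nonneg (by positivity) hp0.le,
      Real.mul_rpow (abs_nonneg _) (by positivity), ← Real.rpow_mul hx.le]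
    congr 3
    field_simp
  have e3 : ∫⁻ x in P, ENNReal.ofReal (ω x ^ ((p - 1) / p)) ^ (p / (p - 1)) =
      ENNReal.ofReal (wInt ω P) := by
    unfold wInt
    rw [ofReal_integral_eq_lintegral_ofReal hωi (ae_of_all _ hω.1)]
    refine lintegral_congr_ae ?_
    filter_upwards [hpos] with x hx
    have hp1 : 0 < p - 1 := by linarith
    rw [ENNReal.ofReal_rpow_of_nonneg (by positivity) (by positivity), ← Real.rpow_mul hx.le]
    have : (p - 1) / p * (p / (p - 1)) = 1 := by field_simp
    rw [this, Real.rpow_one]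
  rw [e1, e2, e3] at hH
  unfold bmoAvg
  set W := ENNReal.ofReal (wInt ω P) with hWdef
  have hW0 : W ≠ 0 := by rw [hWdef]; simpa using hw
  have hWt : W ≠ ∞ := ENNReal.ofReal_ne_top
  rw [ENNReal.ofReal_mul (by positivity), ENNReal.ofReal_inv_of_pos hw]
  calc _ ≤ W⁻¹ * _ := mul_le_mul_right hH _
    _ = _ := by
      rw [ENNReal.mul_rpow_of_nonneg _ _ (by positivity : 0 ≤ 1 / p), ENNReal.inv_rpow,
        ← ENNReal.rpow_neg, ← ENNReal.rpow_neg_one, mul_comm _ (W ^ (1 / (p / (p - 1)))), ← mul_assoc,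
        ← ENNReal.rpow_add _ _ hW0 hWt]
      congr 2
      field_simp
      ring

lemma summ_aux {θ : ℝ} (h0 : 0 < θ) (h1 : θ < 1) (q : ℕ) :
    Summable (fun k : ℕ => ((k : ℝ) + 1) ^ q * θ ^ k) := by
  have := summable_pow_mul_geometric_of_norm_lt_one (R := ℝ) q (r := θ)
    (by rw [Real.norm_eq_abs, abs_of_pos h0]; exact h1)
  have h2 := ((summable_nat_add_iff 1).2 this).mul_right θ⁻¹
  refine h2.congr fun k => ?_
  push_cast
  rw [pow_succ]
  field_simp

lemma pointwise {p : ℝ} (hp : 1 < p) {A w u : ℝ} (hA : 0 < A) (hw : 0 < w) (hu : 0 ≤ u) :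
    ENNReal.ofReal (u ^ p * w ^ (1 - p)) ≤ ∑' k : ℕ,
      ENNReal.ofReal (A ^ p * ((k : ℝ) + 1) ^ ⌈p⌉₊) *
        (if k * A * w < u then ENNReal.ofReal w else 0) := by
  have hp0 : 0 < p := by linarith
  rcases hu.eq_or_lt with rfl | hu
  · rw [Real.zero_rpow hp0.ne']; simp
  have hAw : 0 < A * w := by positivity
  set v := u / (A * w) with hv
  have hvpos : 0 < v := by positivity
  have huv : u = v * (A * w) := by rw [hv]; field_simp
  obtain ⟨k, hk⟩ : ∃ k, ⌈v⌉₊ = k + 1 :=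
    Nat.exists_eq_succ_of_ne_zero (Nat.ceil_pos.2 hvpos).ne'
  have hk1 : (k : ℝ) < v := Nat.lt_ceil.1 (by omega)
  have hk2 : v ≤ k + 1 := by
    have := Nat.le_ceil v
    rw [hk] at this; exact_mod_cast this
  refine le_trans ?_ (ENNReal.le_tsum k)
  rw [if_pos (by rw [huv, mul_assoc]; gcongr), ← ENNReal.ofReal_mul (by positivity)]
  apply ENNReal.ofReal_le_ofReal
  have e : u ^ p * w ^ (1 - p) = A ^ p * v ^ p * w := by
    rw [huv, Real.mul_rpow hvpos.le hAw.le, Real.mul_rpow hA.le hw.le, Real.rpow_sub hw, Real.rpow_one]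
    field_simp
  rw [e]
  gcongr
  calc v ^ p ≤ ((k : ℝ) + 1) ^ p := by gcongr
    _ ≤ ((k : ℝ) + 1) ^ ((⌈p⌉₊ : ℕ) : ℝ) :=
        Real.rpow_le_rpow_of_exponent_le (by linarith [Nat.cast_nonneg (α := ℝ) k]) (Nat.le_ceil p)
    _ = _ := Real.rpow_natCast _ _

lemma main_bound {n : ℕ} {p : ℝ} (hp : 1 < p) {ω : Rn n → ℝ} (hω : IsWeight ω) {K : ℝ}
    (hK1 : 1 ≤ K) (hK : A1cubeBound ω K) {f : Rn n → ℝ} (hf : LocallyIntegrable f volume) {N : ℝ}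
    (hN0 : 0 < N)
    (hN : ∀ (c : Rn n) (h : ℝ), 0 < h →
      ∫ x in cube c h, |f x - avg f (cube c h)| ≤ N * wInt ω (cube c h))
    (c : Rn n) (h : ℝ) (hh : 0 < h) :
    ∫⁻ x in cube c h, ENNReal.ofReal (|f x - avg f (cube c h)| ^ p * (ω x) ^ (1 - p)) ≤
      ENNReal.ofReal ((2 ^ (n+1) * K * N) ^ p *
        ((∑' k : ℕ, ((k : ℝ) + 1) ^ ⌈p⌉₊ * (1 - 1 / (2 * K)) ^ k) + 1)) *
        ENNReal.ofReal (wInt ω (cube c h)) := by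
  have hK0 : 0 < K := by linarith
  set P := cube c h with hP
  set a := avg f P with ha
  set A := 2 ^ (n+1) * K * N with hA
  have hApos : 0 < A := by positivity
  set θ := 1 - 1 / (2 * K) with hθ
  have hθ1 : θ < 1 := by rw [hθ]; have : 0 < 1 / (2 * K) := by positivity
                         linarith
  have hθ0 : 0 < θ := by
    have : 1 / (2 * K) ≤ 1 / 2 := by
      apply one_div_le_one_div_of_le <;> linarith
    rw [hθ]; linarith
  have hfi : IntegrableOn f P := cube_integrable c hh hf
  have hωi : IntegrableOn ω P := cube_integrable c hh hω.2.1
  have hPm : MeasurableSet P := cube_meas c hh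
  have hfm : AEMeasurable (fun x => |f x - a|) volume :=
    (hf.aestronglyMeasurable.aemeasurable.sub_const a).norm
  have hωm : AEMeasurable ω volume := hω.2.1.aestronglyMeasurable.aemeasurable
  have hEm : ∀ k : ℕ, NullMeasurableSet {x | k * A * ω x < |f x - a|} volume := fun k =>
    nullMeasurableSet_lt (hωm.const_mul _) hfm
  have hI : ∀ k : ℕ, ∫⁻ x in P, (if k * A * ω x < |f x - a| then ENNReal.ofReal (ω x) else 0) =
      wMeas ω (P ∩ {x | k * A * ω x < |f x - a|}) := by
    intro k
    unfold wMeas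
    rw [withDensity_apply', inter_comm, ← Measure.restrict_restrict₀ ((hEm k).mono Measure.restrict_le_self),
      ← lintegral_indicator₀ ((hEm k).mono Measure.restrict_le_self)]
    rfl
  have hIm : ∀ k : ℕ, AEMeasurable
      (fun x => if k * A * ω x < |f x - a| then ENNReal.ofReal (ω x) else 0) (volume.restrict P) :=
    fun k => (hωm.ennreal_ofReal.indicator₀ (hEm k)).restrict
  calc _ ≤ ∫⁻ x in P, ∑' k : ℕ, ENNReal.ofReal (A ^ p * ((k : ℝ) + 1) ^ ⌈p⌉₊) *
        (if k * A * ω x < |f x - a| then ENNReal.ofReal (ω x) else 0) := by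
        refine lintegral_mono_ae ?_
        filter_upwards [ae_restrict_of_ae hω.2.2] with x hx
        exact pointwise hp hApos hx (abs_nonneg _)
    _ = ∑' k : ℕ, ENNReal.ofReal (A ^ p * ((k : ℝ) + 1) ^ ⌈p⌉₊) *
        wMeas ω (P ∩ {x | k * A * ω x < |f x - a|}) := by
        rw [lintegral_tsum (fun k => (hIm k).const_mul _)]
        refine tsum_congr fun k => ?_
        rw [lintegral_const_mul'' _ (hIm k), hI]
    _ ≤ ∑' k : ℕ, ENNReal.ofReal (A ^ p * ((k : ℝ) + 1) ^ ⌈p⌉₊) *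
        (ENNReal.ofReal θ ^ k * wMeas ω P) := by
        refine ENNReal.tsum_le_tsum fun k => ?_
        gcongr
        exact good_lambda hω hK1 hK hf hN0 hN k c h hh
    _ = (∑' k : ℕ, ENNReal.ofReal (A ^ p * (((k : ℝ) + 1) ^ ⌈p⌉₊ * θ ^ k))) * wMeas ω P := by
        rw [← ENNReal.tsum_mul_right]
        refine tsum_congr fun k => ?_
        rw [← mul_assoc, ← ENNReal.ofReal_pow hθ0.le, ← ENNReal.ofReal_mul (by positivity), mul_assoc]
    _ ≤ _ := by
        rw [wMeas_eq hω hωi]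
        gcongr
        rw [← ENNReal.ofReal_tsum_of_nonneg (fun k => by positivity)
          ((summ_aux hθ0 hθ1 _).mul_left _), tsum_mul_left]
        apply ENNReal.ofReal_le_ofReal
        gcongr
        linarith

theorem bmoP_norm_equivalence (n : ℕ) (hn : 1 ≤ n) (p : ℝ) (hp : 1 < p)
    (ω : Rn n → ℝ) (hω : IsWeight ω) (hA1 : IsA1cube ω) :
    ∃ C : ℝ, 0 < C ∧ ∀ f : Rn n → ℝ, LocallyIntegrable f volume →
      bmoNormC ω f ≤ bmoPNorm p ω f ∧
      bmoPNorm p ω f ≤ ENNReal.ofReal C * bmoNormC ω f := by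
  obtain ⟨K₀, hK₀, hK₀'⟩ := hA1
  set K := max K₀ 1 with hKdef
  have hK1 : 1 ≤ K := le_max_right _ _
  have hK0 : 0 < K := by linarith
  have hK : A1cubeBound ω K := by
    refine ⟨hK0, fun c h hh => (hK₀' c h hh).trans ?_⟩
    have h1 := hK₀' c h hh
    have h2 : 0 ≤ avg ω (cube c h) :=
      mul_nonneg (by positivity) (integral_nonneg hω.1)
    have h3 : 0 ≤ essInf ω (volume.restrict (cube c h)) := by
      by_contra hcon
      push Not at hcon
      nlinarith
    exact mul_le_mul_of_nonneg_right (le_max_left _ _) h3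
  have hp0 : 0 < p := by linarith
  set M := (∑' k : ℕ, ((k : ℝ) + 1) ^ ⌈p⌉₊ * (1 - 1 / (2 * K)) ^ k) + 1 with hM
  have hθ0 : 0 ≤ 1 - 1 / (2 * K) := by
    have : 1 / (2 * K) ≤ 1 / 2 := by
      apply one_div_le_one_div_of_le <;> linarith
    linarith
  have hMpos : 0 < M := by
    have : 0 ≤ ∑' k : ℕ, ((k : ℝ) + 1) ^ ⌈p⌉₊ * (1 - 1 / (2 * K)) ^ k :=
      tsum_nonneg fun k => by positivity
    linarith
  set C := 2 ^ (n+1) * K * M ^ (1 / p) with hC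
  have hCpos : 0 < C := by positivity
  refine ⟨C, hCpos, fun f hf => ⟨easy_dir hp hω hf, ?_⟩⟩
  have key : ∀ N : ℝ, 0 < N → bmoNormC ω f ≤ ENNReal.ofReal N →
      bmoPNorm p ω f ≤ ENNReal.ofReal (C * N) := by
    intro N hN0 hNle
    have hN : ∀ (c : Rn n) (h : ℝ), 0 < h →
        ∫ x in cube c h, |f x - avg f (cube c h)| ≤ N * wInt ω (cube c h) := by
      intro c h hh
      have h1 : ENNReal.ofReal (bmoAvg ω f (cube c h)) ≤ ENNReal.ofReal N :=
        le_trans (le_iSup_of_le c (le_iSup₂_of_le (f := fun (h : ℝ) (_ : 0 < h) => ENNReal.ofReal (bmoAvg ω f (cube c h))) h hh le_rfl)) hNle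
      rw [ENNReal.ofReal_le_ofReal_iff hN0.le] at h1
      unfold bmoAvg at h1
      rw [inv_mul_le_iff₀ (wInt_pos hω c hh)] at h1
      linarith
    refine iSup_le fun c => iSup_le fun h => iSup_le fun hh => ?_
    have hw := wInt_pos hω c hh
    have hb := main_bound hp hω hK1 hK hf hN0 hN c h hh
    rw [← hM] at hb
    set W := ENNReal.ofReal (wInt ω (cube c h)) with hWdef
    have hW0 : W ≠ 0 := by rw [hWdef]; simpa using hw
    have hWt : W ≠ ∞ := ENNReal.ofReal_ne_top
    calc _ ≤ (W⁻¹ * (ENNReal.ofReal ((2 ^ (n+1) * K * N) ^ p * M) * W)) ^ (1 / p) := by gcongr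
      _ = (ENNReal.ofReal ((2 ^ (n+1) * K * N) ^ p * M)) ^ (1 / p) := by
        rw [mul_comm _ W, ← mul_assoc, ENNReal.inv_mul_cancel hW0 hWt, one_mul]
      _ = _ := by
        rw [ENNReal.ofReal_rpow_of_nonneg (by positivity) (by positivity),
          Real.mul_rpow (by positivity) hMpos.le, ← Real.rpow_mul (by positivity),
          mul_one_div_cancel hp0.ne', Real.rpow_one, hC]
        congr 1
        ring
  by_cases htop : bmoNormC ω f = ∞
  · rw [htop, ENNReal.mul_top (by simpa using hCpos)]; exact le_top
  refine ENNReal.le_of_forall_pos_le_add fun ε hε _ => ?_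
  have hεC : 0 < (ε : ℝ) / C := div_pos (by exact_mod_cast hε) hCpos
  have h1 := key ((bmoNormC ω f).toReal + ε / C) (by positivity) (by
    rw [ENNReal.ofReal_add ENNReal.toReal_nonneg hεC.le, ENNReal.ofReal_toReal htop]
    exact le_self_add)
  refine h1.trans (le_of_eq ?_)
  rw [mul_add, ENNReal.ofReal_add (by positivity) (by positivity), ENNReal.ofReal_mul hCpos.le,
    ENNReal.ofReal_toReal htop, mul_div_cancel₀ _ hCpos.ne', ENNReal.ofReal_coe_nnreal]

end LPW
end
end

section
/- Let F be a nonnegative, locally square-integrable measurable function on ℝⁿ such that F² ∈ BLO. Then F ∈ BLO and ‖F‖²_{BLO} ≤ ‖F²‖_{BLO}; that is, for every ball B ⊂ ℝⁿ one has (1/m(B)) ∫_B [F(x) − essinf_{y∈B} F(y)] dx ≤ (‖F²‖_{BLO})^{1/2}. -/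
open MeasureTheory Metric Set ENNReal

noncomputable section

namespace LPW

variable {n : ℕ}

lemma blo_key (n : ℕ) (F : Rn n → ℝ)
    (hF0 : ∀ x, 0 ≤ F x) (hFm : AEStronglyMeasurable F volume)
    (hFsq : LocallyIntegrable (fun x => F x ^ 2) volume) (c : Rn n) (ρ : ℝ) (hρ : 0 < ρ) :
    0 ≤ bloAvg (fun _ => (1 : ℝ)) F (Metric.ball c ρ) ∧
    (bloAvg (fun _ => (1 : ℝ)) F (Metric.ball c ρ)) ^ 2 ≤
      bloAvg (fun _ => (1 : ℝ)) (fun x => F x ^ 2) (Metric.ball c ρ) := by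
  set μ : Measure (Rn n) := volume.restrict (Metric.ball c ρ) with hμ
  have hvpos : 0 < volume (Metric.ball c ρ) := Metric.measure_ball_pos _ _ hρ
  have hvfin : volume (Metric.ball c ρ) < ⊤ := measure_ball_lt_top
  have : IsFiniteMeasure μ := ⟨by simpa [hμ] using hvfin⟩
  have hμ0 : μ ≠ 0 := by
    intro h
    have : μ univ = 0 := by simp [h]
    simp [hμ] at this
    exact absurd this hvpos.ne'
  have : NeZero μ := ⟨hμ0⟩
  have hsqi : Integrable (fun x => F x ^ 2) μ :=
    (hFsq.integrableOn_isCompact (isCompact_closedBall c ρ)).mono_set ball_subset_closedBall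
  have hm : AEStronglyMeasurable F μ := hFm.restrict
  have hL2 : MemLp F 2 μ := (memLp_two_iff_integrable_sq hm).2 hsqi
  have hFi : Integrable F μ := hL2.integrable (by norm_num)
  have hV : wInt (fun _ => (1:ℝ)) (Metric.ball c ρ) = μ.real univ := by
    simp [wInt, hμ, Measure.real]
  have hVpos : 0 < μ.real univ := by
    rw [measureReal_def]
    exact ENNReal.toReal_pos (by simpa using hμ0) (measure_ne_top _ _)
  have bdd : ∀ G : Rn n → ℝ, (∀ x, 0 ≤ G x) → Filter.IsBoundedUnder (· ≥ ·) (ae μ) G := by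
    intro G hG
    exact ⟨0, by simpa using Filter.Eventually.of_forall hG⟩
  have hcob : Filter.IsCoboundedUnder (· ≥ ·) (ae μ) F := by
    obtain ⟨N, hN⟩ : ∃ N : ℕ, ∃ᶠ x in ae μ, F x ≤ N := by
      by_contra hcon
      push Not at hcon
      have h1 : ∀ᵐ x ∂μ, ∀ N : ℕ, (N:ℝ) < F x := by
        rw [ae_all_iff]; intro N; simpa using hcon N
      obtain ⟨x, hx⟩ := h1.exists
      obtain ⟨N, hN⟩ := exists_nat_ge (F x)
      exact absurd (hx N) (not_lt.2 hN)
    exact Filter.IsCoboundedUnder.of_frequently_le hN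
  set a := essInf F μ with ha
  set s := essInf (fun x => F x ^ 2) μ with hs
  have hFa : ∀ᵐ x ∂μ, a ≤ F x := ae_essInf_le (bdd F hF0)
  have hFs : ∀ᵐ x ∂μ, s ≤ F x ^ 2 := ae_essInf_le (bdd _ fun x => sq_nonneg _)
  have hsa : Real.sqrt s ≤ a := by
    refine Filter.le_liminf_of_le hcob ?_
    filter_upwards [hFs] with x hx
    exact (Real.sqrt_le_left (hF0 x)).2 hx
  have ha0 : 0 ≤ a := (Real.sqrt_nonneg _).trans hsa
  have hsa2 : s ≤ a ^ 2 := (Real.sqrt_le_left ha0).1 hsa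
  set V := μ.real univ
  have e1 : bloAvg (fun _ => (1 : ℝ)) F (Metric.ball c ρ) = V⁻¹ * ∫ x, (F x - a) ∂μ := by
    rw [bloAvg, hV]
  have e2 : bloAvg (fun _ => (1 : ℝ)) (fun x => F x ^ 2) (Metric.ball c ρ)
      = V⁻¹ * ∫ x, (F x ^ 2 - s) ∂μ := by
    rw [bloAvg, hV]
  rw [e1, e2]
  set I := ∫ x, (F x - a) ∂μ with hI
  have hI0 : 0 ≤ I := integral_nonneg_of_ae (by
    filter_upwards [hFa] with x hx
    simpa using hx)
  have hGi : Integrable (fun x => F x - a) μ := hFi.sub (integrable_const a)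
  have hSi : Integrable (fun x => F x ^ 2 - s) μ := hsqi.sub (integrable_const s)
  refine ⟨by positivity, ?_⟩
  set t := V⁻¹ * I with ht
  have hIt : I = t * V := by rw [ht]; field_simp
  have h2 : ∫ x, (2 * t * (F x - a) - t ^ 2) ∂μ ≤ ∫ x, (F x ^ 2 - s) ∂μ := by
    refine integral_mono_ae ((hGi.const_mul _).sub (integrable_const _)) hSi ?_
    filter_upwards [hFa] with x hx
    change 2 * t * (F x - a) - t ^ 2 ≤ F x ^ 2 - s
    nlinarith [sq_nonneg (F x - a - t), mul_nonneg ha0 (sub_nonneg.2 hx)]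
  rw [integral_sub (hGi.const_mul _) (integrable_const _), integral_const_mul, ← hI,
    integral_const, smul_eq_mul] at h2
  change 2 * t * I - V * t ^ 2 ≤ _ at h2
  rw [inv_mul_eq_div, le_div_iff₀ hVpos]
  rw [hIt] at h2
  linarith

theorem blo_sq_le_blo_of_sq (n : ℕ) (hn : 1 ≤ n) (F : Rn n → ℝ)
    (hF0 : ∀ x, 0 ≤ F x) (hFm : AEStronglyMeasurable F volume)
    (hFsq : LocallyIntegrable (fun x => F x ^ 2) volume)
    (hblo : bloNorm (fun _ => (1 : ℝ)) (fun x => F x ^ 2) < ⊤) :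
    bloNorm (fun _ => (1 : ℝ)) F < ⊤ ∧
    (bloNorm (fun _ => (1 : ℝ)) F) ^ 2 ≤ bloNorm (fun _ => (1 : ℝ)) (fun x => F x ^ 2) ∧
    ∀ (c : Rn n) (ρ : ℝ), 0 < ρ →
      bloAvg (fun _ => (1 : ℝ)) F (Metric.ball c ρ)
        ≤ ((bloNorm (fun _ => (1 : ℝ)) (fun x => F x ^ 2)).toReal) ^ (1/2 : ℝ) := by
  set N := bloNorm (fun _ => (1 : ℝ)) (fun x => F x ^ 2) with hN
  have hk := blo_key n F hF0 hFm hFsq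
  have key : ∀ (c : Rn n) (ρ : ℝ), 0 < ρ →
      bloAvg (fun _ => (1 : ℝ)) F (Metric.ball c ρ) ≤ (N.toReal) ^ (1/2 : ℝ) := by
    intro c ρ hρ
    rw [← Real.sqrt_eq_rpow]
    refine Real.le_sqrt_of_sq_le ((hk c ρ hρ).2.trans ?_)
    refine (ENNReal.ofReal_le_iff_le_toReal hblo.ne).1 ?_
    exact le_iSup_of_le c (le_iSup_of_le ρ (le_iSup_of_le hρ le_rfl))
  have hle : bloNorm (fun _ => (1 : ℝ)) F ≤ ENNReal.ofReal ((N.toReal) ^ (1/2 : ℝ)) :=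
    iSup_le fun c => iSup_le fun ρ => iSup_le fun hρ => ENNReal.ofReal_le_ofReal (key c ρ hρ)
  refine ⟨hle.trans_lt ENNReal.ofReal_lt_top, ?_, key⟩
  calc (bloNorm (fun _ => (1 : ℝ)) F) ^ 2 ≤ (ENNReal.ofReal ((N.toReal) ^ (1/2 : ℝ))) ^ 2 := by
        gcongr
    _ = N := by
        rw [← ENNReal.ofReal_pow (by positivity), ← Real.sqrt_eq_rpow,
          Real.sq_sqrt ENNReal.toReal_nonneg, ENNReal.ofReal_toReal hblo.ne]
end LPW
end
end
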